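/- arXiv:2601.03180 — 2 statements merged into one kernel-verified Lean document; each statement's English description precedes it below -/
import Mathlib

section
/- Let Σ be a finitary signature with all arities 0 or 1 and E a set of quantitative equations over Σ. For an extended metric space X, write T_E X for the metric reflection of (T_Σ|X|, d_X^E) with reflection map q_X, and for a set S write T_E S for the same construction applied to S with the discrete metric (distinct points at distance ∞), with reflection map q_S; for a map g between sets, T_E g denotes the induced nonexpanding map between reflections (descending the relabeling homomorphism T_Σ g). Let Y be an extended metric space and f : T_E|X| → Y a nonexpanding map such that for every δ > 0, with Δ_δ X = {(x,x') ∈ X × X : d_X(x,x') ≤ δ} and projections l_δ, r_δ : Δ_δ X → |X|, one has d_Y(f(T_E l_δ(a)), f(T_E r_δ(a))) ≤ δ for all a ∈ T_E(Δ_δ X). Then there exists a nonexpanding map f' : T_E X → Y with f'(q_X(t)) = f(q_{|X|}(t)) for all terms t ∈ T_Σ|X|. -/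
open ENNReal NNReal

/-- Σ-terms with variables in `X`, for a finitary signature `Sg`. -/
inductive Term (Sg : ℕ → Type) (X : Type) : Type
  | var : X → Term Sg X
  | op : ∀ {n : ℕ}, Sg n → (Fin n → Term Sg X) → Term Sg X

/-- The homomorphic extension of a valuation `f : X → A` to terms. -/
def evalT {Sg : ℕ → Type} {X : Type} {A : Type}
    (ops : ∀ n, Sg n → (Fin n → A) → A) (f : X → A) : Term Sg X → A
  | .var x => f x
  | .op σ t => ops _ σ (fun i => evalT ops f (t i))

/-- `d` is an extended metric on `X`. -/
def IsEMet {X : Type} (d : X → X → ℝ≥0∞) : Prop :=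
  (∀ x, d x x = 0) ∧ (∀ x y, d x y = 0 → x = y) ∧ (∀ x y, d x y = d y x) ∧
    (∀ x y z, d x z ≤ d x y + d y z)

/-- `(A, dA, ops)` is a quantitative `Σ`-algebra: `dA` is an extended metric and every
operation is nonexpanding for the maximum metric on powers. -/
def IsQAlg {Sg : ℕ → Type} {A : Type} (dA : A → A → ℝ≥0∞)
    (ops : ∀ n, Sg n → (Fin n → A) → A) : Prop :=
  IsEMet dA ∧ ∀ n (σ : Sg n) (a b : Fin n → A),
    dA (ops n σ a) (ops n σ b) ≤ ⨆ i : Fin n, dA (a i) (b i)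

/-- A quantitative equation `lhs =_eps rhs` over a finite set of variables. -/
structure QEq (Sg : ℕ → Type) where
  k : ℕ
  lhs : Term Sg (Fin k)
  rhs : Term Sg (Fin k)
  eps : ℝ≥0

/-- The algebra `(A, dA, ops)` satisfies the quantitative equation `t =_ε t'`. -/
def SatQ {Sg : ℕ → Type} {A : Type} (dA : A → A → ℝ≥0∞)
    (ops : ∀ n, Sg n → (Fin n → A) → A) {V : Type} (t t' : Term Sg V) (ε : ℝ≥0∞) : Prop :=
  ∀ f : V → A, dA (evalT ops f t) (evalT ops f t') ≤ ε

/-- `d̄_X (t, t') = inf { ε : every quantitative Σ-algebra satisfying all equations of E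
satisfies t =_ε t' }` (the infimum of the empty set being `∞`). -/
noncomputable def dBar (Sg : ℕ → Type) (E : Set (QEq Sg)) {X : Type}
    (t t' : Term Sg X) : ℝ≥0∞ :=
  sInf {ε : ℝ≥0∞ | ∀ (A : Type) (dA : A → A → ℝ≥0∞) (ops : ∀ n, Sg n → (Fin n → A) → A),
    IsQAlg dA ops → (∀ e ∈ E, SatQ dA ops e.lhs e.rhs (e.eps : ℝ≥0∞)) →
    SatQ dA ops t t' ε}

open scoped Classical in
/-- The metric `d_X^*` on terms: distances of variables are taken from `X`, composite
terms with the same head symbol get the maximum of the distances of their children, and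
all other pairs (non-similar terms) have distance `∞`. -/
noncomputable def dStar {Sg : ℕ → Type} {X : Type} (dX : X → X → ℝ≥0∞) :
    Term Sg X → Term Sg X → ℝ≥0∞
  | .var x, .var y => dX x y
  | .op (n := n) σ t, .op (n := m) τ t' =>
      if h : n = m then
        (if HEq σ τ then ⨆ i : Fin n, dStar dX (t i) (t' (Fin.cast h i)) else ∞)
      else ∞
  | _, _ => ∞

/-- The meet of two extended pseudometrics, via the chain-infimum construction. -/
noncomputable def pmeet {X : Type} (d' d'' : X → X → ℝ≥0∞) (x y : X) : ℝ≥0∞ :=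
  sInf {r : ℝ≥0∞ | ∃ (n : ℕ) (s : ℕ → X), s 0 = x ∧ s n = y ∧
    r = ∑ i ∈ Finset.range n, min (d' (s i) (s (i + 1))) (d'' (s i) (s (i + 1)))}

/-- The homomorphic relabeling of variables along a map `v : V → W`. -/
def renameT {Sg : ℕ → Type} {V W : Type} (v : V → W) : Term Sg V → Term Sg W
  | .var x => .var (v x)
  | .op σ t => .op σ (fun i => renameT v (t i))

open scoped Classical in
/-- The discrete extended metric on a set: all nonzero distances are `∞`. -/
noncomputable def ddisc {α : Type} (x y : α) : ℝ≥0∞ := if x = y then 0 else ∞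

/-- Terms at finite distance at most `δ` are the two relabelings of a single term whose variables
are pairs of points at distance at most `δ`. -/
theorem exists_renameT_eq_of_dStar_le {Sg : ℕ → Type} {X : Type} {dX : X → X → ℝ≥0∞}
    {δ : ℝ≥0∞} (hδ : δ < ∞) (t t' : Term Sg X) (h : dStar dX t t' ≤ δ) :
    ∃ a : Term Sg {p : X × X // dX p.1 p.2 ≤ δ},
      renameT (fun p => p.1.1) a = t ∧ renameT (fun p => p.1.2) a = t' := by
  induction t generalizing t' with
  | var x =>
    cases t' with
    | var y => exact ⟨.var ⟨(x, y), by simpa [dStar] using h⟩, rfl, rfl⟩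
    | op τ s' => simp [dStar, hδ.ne] at h
  | @op n σ s ih =>
    cases t' with
    | var y => simp [dStar, hδ.ne] at h
    | @op m τ s' =>
      rw [dStar] at h
      split_ifs at h with hnm hστ
      · subst hnm
        obtain rfl := eq_of_heq hστ
        choose a ha ha' using fun i => ih i (s' i) ((le_iSup _ i).trans h)
        exact ⟨.op σ a, by simp [renameT, ha], by simp [renameT, ha']⟩
      · exact absurd h hδ.not_ge
      · exact absurd h hδ.not_ge

theorem pmeet_le_right {X : Type} (d' d'' : X → X → ℝ≥0∞) (x y : X) :
    pmeet d' d'' x y ≤ d'' x y := by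
  refine le_trans (sInf_le ⟨1, fun i => if i = 0 then x else y, rfl, rfl, rfl⟩) ?_
  simp

/-- The meet is the greatest pseudometric below both of its arguments. -/
theorem le_pmeet {X : Type} {d d' d'' : X → X → ℝ≥0∞} (hself : ∀ x, d x x = 0)
    (htri : ∀ x y z, d x z ≤ d x y + d y z) (h' : ∀ x y, d x y ≤ d' x y)
    (h'' : ∀ x y, d x y ≤ d'' x y) (x y : X) : d x y ≤ pmeet d' d'' x y := by
  refine le_sInf ?_
  rintro _ ⟨n, s, rfl, rfl, rfl⟩
  induction n with
  | zero => simp [hself]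
  | succ n ih =>
    rw [Finset.sum_range_succ]
    exact (htri _ (s n) _).trans (add_le_add ih (le_min (h' _ _) (h'' _ _)))

/-- For a signature with arities 0 and 1 only and a set `E` of quantitative
equations, write `T_E X` for the metric reflection of `(T_Σ|X|, d_X^E)`. If a
nonexpanding map `f : T_E|X| → Y` satisfies
`d_Y (f (T_E l_δ a), f (T_E r_δ a)) ≤ δ` for all `δ > 0` and `a ∈ T_E (Δ_δ X)`, then `f`
factorizes through `T_E i_X` via a nonexpanding map `f' : T_E X → Y`. -/
theorem factorization_through_TEiX_unary {Sg : ℕ → Type}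
    (hSg : ∀ n, 2 ≤ n → IsEmpty (Sg n))
    (E : Set (QEq Sg)) {X : Type} (dX : X → X → ℝ≥0∞) (hdX : IsEMet dX)
    -- T_E X : the metric reflection of (T_Σ|X|, d_X^E) built from the metric dX :
    (QX : Type) (dQX : QX → QX → ℝ≥0∞) (qX : Term Sg X → QX)
    (hqX_surj : Function.Surjective qX)
    (hqX_pres : ∀ t t' : Term Sg X,
      dQX (qX t) (qX t') = pmeet (dStar dX) (dBar Sg E) t t')
    (hQX_sep : ∀ u v : QX, dQX u v = 0 → u = v)
    -- T_E |X| : the same construction for the underlying set with the discrete metric :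
    (QD : Type) (dQD : QD → QD → ℝ≥0∞) (qD : Term Sg X → QD)
    (hqD_surj : Function.Surjective qD)
    (hqD_pres : ∀ t t' : Term Sg X,
      dQD (qD t) (qD t') = pmeet (dStar ddisc) (dBar Sg E) t t')
    (hQD_sep : ∀ u v : QD, dQD u v = 0 → u = v)
    -- T_E (Δ_δ X) : the construction for the sets Δ_δ X with the discrete metric :
    (QΔ : ℝ≥0∞ → Type) (dQΔ : ∀ δ, QΔ δ → QΔ δ → ℝ≥0∞)
    (qΔ : ∀ δ, Term Sg {p : X × X // dX p.1 p.2 ≤ δ} → QΔ δ)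
    (hqΔ_surj : ∀ δ, Function.Surjective (qΔ δ))
    (hqΔ_pres : ∀ δ (t t' : Term Sg {p : X × X // dX p.1 p.2 ≤ δ}),
      dQΔ δ (qΔ δ t) (qΔ δ t') = pmeet (dStar ddisc) (dBar Sg E) t t')
    (hQΔ_sep : ∀ δ (u v : QΔ δ), dQΔ δ u v = 0 → u = v)
    -- T_E l_δ and T_E r_δ : the maps induced by the left and right projections :
    (Tl Tr : ∀ δ, QΔ δ → QD)
    (hTl : ∀ δ (t : Term Sg {p : X × X // dX p.1 p.2 ≤ δ}),
      Tl δ (qΔ δ t) = qD (renameT (fun p => p.1.1) t))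
    (hTr : ∀ δ (t : Term Sg {p : X × X // dX p.1 p.2 ≤ δ}),
      Tr δ (qΔ δ t) = qD (renameT (fun p => p.1.2) t))
    (hTl_ne : ∀ δ (u v : QΔ δ), dQD (Tl δ u) (Tl δ v) ≤ dQΔ δ u v)
    (hTr_ne : ∀ δ (u v : QΔ δ), dQD (Tr δ u) (Tr δ v) ≤ dQΔ δ u v)
    -- the nonexpanding map f : T_E|X| → Y :
    {Y : Type} (dY : Y → Y → ℝ≥0∞) (hdY : IsEMet dY)
    (f : QD → Y) (hf_ne : ∀ u v : QD, dY (f u) (f v) ≤ dQD u v)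
    -- the hypothesis: d_Y (f (T_E l_δ a), f (T_E r_δ a)) ≤ δ for all δ > 0 :
    (hf : ∀ δ : ℝ≥0∞, 0 < δ → ∀ a : QΔ δ, dY (f (Tl δ a)) (f (Tr δ a)) ≤ δ) :
    -- conclusion: f factorizes through T_E i_X via a nonexpanding map f' :
    ∃ f' : QX → Y, (∀ u v : QX, dY (f' u) (f' v) ≤ dQX u v) ∧
      ∀ t : Term Sg X, f' (qX t) = f (qD t) := by
  have hbar (t t' : Term Sg X) : dY (f (qD t)) (f (qD t')) ≤ dBar Sg E t t' :=
    (hf_ne _ _).trans ((hqD_pres t t').trans_le (pmeet_le_right _ _ t t'))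
  have hstar (t t' : Term Sg X) : dY (f (qD t)) (f (qD t')) ≤ dStar dX t t' := by
    refine le_of_forall_gt_imp_ge_of_dense fun δ hδ => ?_
    rcases eq_or_ne δ ∞ with rfl | htop
    · exact le_top
    · obtain ⟨a, rfl, rfl⟩ := exists_renameT_eq_of_dStar_le htop.lt_top t t' hδ.le
      simpa only [hTl, hTr] using hf δ (bot_le.trans_lt hδ) (qΔ δ a)
  have hle (t t' : Term Sg X) : dY (f (qD t)) (f (qD t')) ≤ dQX (qX t) (qX t') := by
    rw [hqX_pres]
    exact le_pmeet (d := fun t t' => dY (f (qD t)) (f (qD t'))) (fun _ => hdY.1 _)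
      (fun _ _ _ => hdY.2.2.2 _ _ _) hstar hbar t t'
  choose r hr using hqX_surj
  refine ⟨fun u => f (qD (r u)), fun u v => by simpa only [hr] using hle (r u) (r v), fun t => ?_⟩
  refine hdY.2.1 _ _ (le_antisymm ((hle _ _).trans ?_) bot_le)
  rw [hr, hqX_pres]
  exact sInf_le ⟨0, fun _ => t, rfl, rfl, by simp⟩
end

section
/- Let Σ be a finitary signature, E a set of ordinary equations over Σ, and X an extended metric space. Let q : (T_Σ|X|, d_X^@) → T_E X be the metric reflection (identifying terms at d_X^@-distance 0) equipped with the induced quantitative Σ-algebra structure. Then: (a) T_E X satisfies every equation of E; (b) q ∘ η_X : X → T_E X is nonexpanding; and (c) T_E X is the free algebra on X in the variety of quantitative Σ-algebras presented by E: for every quantitative Σ-algebra B satisfying all equations of E and every nonexpanding map f : X → B there is a unique nonexpanding homomorphism h : T_E X → B with h ∘ (q ∘ η_X) = f. -/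
open ENNReal NNReal

/-- An ordinary equation `lhs = rhs` over a finite set of variables. -/
structure OrdEq (Sg : ℕ → Type) where
  k : ℕ
  lhs : Term Sg (Fin k)
  rhs : Term Sg (Fin k)

/-- The Σ-algebra `(A, ops)` satisfies the ordinary equation `t = t'`: every valuation's
homomorphic extension sends `t` and `t'` to the same element. -/
def SatOrd {Sg : ℕ → Type} {A : Type} (ops : ∀ n, Sg n → (Fin n → A) → A)
    {V : Type} (t t' : Term Sg V) : Prop :=
  ∀ f : V → A, evalT ops f t = evalT ops f t'

/-- `t ≈ t'` iff every Σ-algebra satisfying all equations of `E` satisfies `t = t'`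
under every valuation. -/
def approxE (Sg : ℕ → Type) (E : Set (OrdEq Sg)) {X : Type} (t t' : Term Sg X) : Prop :=
  ∀ (A : Type) (ops : ∀ n, Sg n → (Fin n → A) → A),
    (∀ e ∈ E, SatOrd ops e.lhs e.rhs) → SatOrd ops t t'

/-- The extended pseudometric `d_X^@`:
`d_X^@ (u, v) = inf Σ_{i=0}^{n} d_X^* (s 2i, s (2i+1))`, the infimum ranging over all
sequences of terms `u = s 0, s 1, …, s (2n+1) = v` with `s (2i-1) ≈ s (2i)` for
`i = 1, …, n`. -/
noncomputable def dAt (Sg : ℕ → Type) (E : Set (OrdEq Sg)) {X : Type}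
    (dX : X → X → ℝ≥0∞) (u v : Term Sg X) : ℝ≥0∞ :=
  sInf {r : ℝ≥0∞ | ∃ (n : ℕ) (s : ℕ → Term Sg X), s 0 = u ∧ s (2 * n + 1) = v ∧
    (∀ i, 1 ≤ i → i ≤ n → approxE Sg E (s (2 * i - 1)) (s (2 * i))) ∧
    r = ∑ i ∈ Finset.range (n + 1), dStar dX (s (2 * i)) (s (2 * i + 1))}

theorem evalT_subst {Sg : ℕ → Type} {V X A : Type} (ops : ∀ n, Sg n → (Fin n → A) → A)
    (f : X → A) (g : V → Term Sg X) (t : Term Sg V) :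
    evalT ops f (evalT (fun _ σ a => Term.op σ a) g t) =
      evalT ops (fun v => evalT ops f (g v)) t := by
  induction t with
  | var x => rfl
  | op σ t ih =>
    simp only [evalT]
    congr 1
    funext i
    exact ih i

theorem map_evalT_of_hom {Sg : ℕ → Type} {V A B : Type} {opsA : ∀ n, Sg n → (Fin n → A) → A}
    {opsB : ∀ n, Sg n → (Fin n → B) → B} {h : A → B}
    (hh : ∀ n (σ : Sg n) (a : Fin n → A), h (opsA n σ a) = opsB n σ (fun i => h (a i)))
    (f : V → A) (t : Term Sg V) :
    h (evalT opsA f t) = evalT opsB (fun v => h (f v)) t := by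
  induction t with
  | var x => rfl
  | op σ t ih =>
    simp only [evalT, hh]
    congr 1
    funext i
    exact ih i

theorem approxE_evalT_op {Sg : ℕ → Type} {E : Set (OrdEq Sg)} {X : Type} {e : OrdEq Sg}
    (he : e ∈ E) (g : Fin e.k → Term Sg X) :
    approxE Sg E (evalT (fun _ σ a => Term.op σ a) g e.lhs)
      (evalT (fun _ σ a => Term.op σ a) g e.rhs) := by
  intro A ops hE f
  rw [evalT_subst, evalT_subst]
  exact hE e he _

theorem dStar_self {Sg : ℕ → Type} {X : Type} {dX : X → X → ℝ≥0∞} (hdX : ∀ x, dX x x = 0)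
    (t : Term Sg X) : dStar dX t t = 0 := by
  induction t with
  | var x => simpa [dStar] using hdX x
  | op σ t ih => simp [dStar, ih]

theorem dist_evalT_le_dStar {Sg : ℕ → Type} {X B : Type} {dX : X → X → ℝ≥0∞}
    {dB : B → B → ℝ≥0∞} {opsB : ∀ n, Sg n → (Fin n → B) → B} (hB : IsQAlg dB opsB)
    {f : X → B} (hf : ∀ x y, dB (f x) (f y) ≤ dX x y) (s t : Term Sg X) :
    dB (evalT opsB f s) (evalT opsB f t) ≤ dStar dX s t := by
  induction s generalizing t with
  | var x =>
    cases t with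
    | var y => simpa [dStar, evalT] using hf x y
    | op τ t => simp [dStar]
  | @op n σ s ih =>
    cases t with
    | var y => simp [dStar]
    | @op m τ t =>
      by_cases h : n = m
      · subst h
        by_cases hστ : σ = τ
        · subst hστ
          simp only [dStar, evalT, dite_true, HEq.rfl, if_true, Fin.cast_eq_self]
          exact (hB.2 _ σ _ _).trans (iSup_mono fun i => ih i _)
        · simp [dStar, hστ]
      · simp [dStar, h]

theorem dAt_le_dStar {Sg : ℕ → Type} (E : Set (OrdEq Sg)) {X : Type} (dX : X → X → ℝ≥0∞)
    (u v : Term Sg X) : dAt Sg E dX u v ≤ dStar dX u v := by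
  refine sInf_le ⟨0, fun i => if i = 0 then u else v, rfl, rfl, ?_, by simp⟩
  intro i h1 h0
  omega

theorem dAt_eq_zero_of_approxE {Sg : ℕ → Type} {E : Set (OrdEq Sg)} {X : Type}
    {dX : X → X → ℝ≥0∞} (hdX : ∀ x, dX x x = 0) {u v : Term Sg X} (h : approxE Sg E u v) :
    dAt Sg E dX u v = 0 := by
  refine nonpos_iff_eq_zero.mp (sInf_le ⟨1, fun i => if i ≤ 1 then u else v, rfl, rfl, ?_, ?_⟩)
  · intro i h1 h2
    obtain rfl : i = 1 := le_antisymm h2 h1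
    simpa using h
  · simp [Finset.sum_range_succ, dStar_self hdX]

theorem dist_evalT_le_dAt {Sg : ℕ → Type} {E : Set (OrdEq Sg)} {X B : Type}
    {dX : X → X → ℝ≥0∞} {dB : B → B → ℝ≥0∞} {opsB : ∀ n, Sg n → (Fin n → B) → B}
    (hB : IsQAlg dB opsB) (hE : ∀ e ∈ E, SatOrd opsB e.lhs e.rhs)
    {f : X → B} (hf : ∀ x y, dB (f x) (f y) ≤ dX x y) (u v : Term Sg X) :
    dB (evalT opsB f u) (evalT opsB f v) ≤ dAt Sg E dX u v := by
  refine le_sInf ?_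
  rintro r ⟨n, s, rfl, rfl, hs, rfl⟩
  induction n with
  | zero => simpa using dist_evalT_le_dStar hB hf (s 0) (s 1)
  | succ n ih =>
    rw [Finset.sum_range_succ]
    have hmid : evalT opsB f (s (2 * n + 1)) = evalT opsB f (s (2 * (n + 1))) :=
      hs (n + 1) (by omega) le_rfl B opsB hE f
    refine (hB.1.2.2.2 _ (evalT opsB f (s (2 * n + 1))) _).trans (add_le_add ?_ ?_)
    · exact ih fun i h1 h2 => hs i h1 (by omega)
    · rw [hmid]
      exact dist_evalT_le_dStar hB hf _ _

/-- Let `q : (T_Σ|X|, d_X^@) → Q` be the metric reflection of the term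
algebra, equipped with the induced quantitative Σ-algebra structure. Then (a) `Q`
satisfies every equation of `E`, (b) `q ∘ η_X` is nonexpanding, and (c) `Q` is the free
algebra on `X` in the variety of quantitative Σ-algebras presented by `E`. -/
theorem free_algebra_ordinary_equations {Sg : ℕ → Type} (E : Set (OrdEq Sg))
    {X : Type} (dX : X → X → ℝ≥0∞) (hdX : IsEMet dX)
    -- the metric reflection q : (T_Σ|X|, d_X^@) → Q :
    (Q : Type) (dQ : Q → Q → ℝ≥0∞) (q : Term Sg X → Q)
    (hq_surj : Function.Surjective q)
    (hq_pres : ∀ t t' : Term Sg X, dQ (q t) (q t') = dAt Sg E dX t t')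
    (hQ_sep : ∀ u v : Q, dQ u v = 0 → u = v)
    -- the induced quantitative Σ-algebra structure on Q (q is a homomorphism) :
    (opsQ : ∀ n, Sg n → (Fin n → Q) → Q)
    (hq_hom : ∀ n (σ : Sg n) (a : Fin n → Term Sg X),
      opsQ n σ (fun i => q (a i)) = q (Term.op σ a))
    (hopsQ : ∀ n (σ : Sg n) (a b : Fin n → Q),
      dQ (opsQ n σ a) (opsQ n σ b) ≤ ⨆ i : Fin n, dQ (a i) (b i)) :
    -- (a) Q satisfies every equation of E :
    (∀ e ∈ E, SatOrd opsQ e.lhs e.rhs) ∧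
    -- (b) q ∘ η_X is nonexpanding :
    (∀ x y : X, dQ (q (Term.var x)) (q (Term.var y)) ≤ dX x y) ∧
    -- (c) Q is the free algebra on X in the variety presented by E :
    (∀ (B : Type) (dB : B → B → ℝ≥0∞) (opsB : ∀ n, Sg n → (Fin n → B) → B),
      IsQAlg dB opsB → (∀ e ∈ E, SatOrd opsB e.lhs e.rhs) →
      ∀ f : X → B, (∀ x y : X, dB (f x) (f y) ≤ dX x y) →
      ∃! h : Q → B,
        (∀ u v : Q, dB (h u) (h v) ≤ dQ u v) ∧
        (∀ n (σ : Sg n) (b : Fin n → Q), h (opsQ n σ b) = opsB n σ (fun i => h (b i))) ∧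
        (∀ x : X, h (q (Term.var x)) = f x)) := by
  have hhom : ∀ n (σ : Sg n) (a : Fin n → Term Sg X),
      q (Term.op σ a) = opsQ n σ (fun i => q (a i)) := fun n σ a => (hq_hom n σ a).symm
  refine ⟨?_, ?_, ?_⟩
  · intro e he f
    choose g hg using fun i => hq_surj (f i)
    obtain rfl : (fun i => q (g i)) = f := funext hg
    have hmap := map_evalT_of_hom (opsA := fun _ σ a => Term.op σ a) hhom g
    rw [← hmap, ← hmap]
    apply hQ_sep
    rw [hq_pres]
    exact dAt_eq_zero_of_approxE hdX.1 (approxE_evalT_op he g)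
  · intro x y
    rw [hq_pres]
    simpa [dStar] using dAt_le_dStar E dX (Term.var x) (Term.var y)
  · intro B dB opsB hB hE f hf
    have hle := dist_evalT_le_dAt hB hE hf
    choose p hp using hq_surj
    have hlift : ∀ t, evalT opsB f (p (q t)) = evalT opsB f t := fun t => by
      refine hB.1.2.1 _ _ (nonpos_iff_eq_zero.mp ((hle _ _).trans ?_))
      have hself : dAt Sg E dX t t = 0 := dAt_eq_zero_of_approxE hdX.1 fun _ _ _ _ => rfl
      rw [← hq_pres, hp, hq_pres, hself]
    refine ⟨fun u => evalT opsB f (p u), ⟨?_, ?_, fun x => hlift _⟩, ?_⟩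
    · intro u v
      have := hle (p u) (p v)
      rwa [← hq_pres, hp, hp] at this
    · intro n σ b
      have hb : opsQ n σ b = q (Term.op σ fun i => p (b i)) := by
        simp only [hhom, hp]
      simp only [hb, hlift, evalT]
    · rintro h ⟨-, hh, hv⟩
      have key : ∀ t, h (q t) = evalT opsB f t := fun t => by
        induction t with
        | var x => exact hv x
        | op σ t ih => simp only [hhom, hh, ih, evalT]
      funext u
      rw [← key, hp]
end
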